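/- arXiv:2509.10954 — 2 statements merged into one kernel-verified Lean document; each statement's English description precedes it below -/
import Mathlib

section
/- Let n ≥ 2, d ≥ 1, let 0 ≤ α < 1/(2n−3), and let a₀, …, a_n be constants with a₀ > 0, a_n > 0, a_i ≥ 0. Let c : [0,1] → ℝ^d be an immersion of class H^{n+1}. Then for every t ∈ (0,1] the curve θ ↦ t^α·c(tθ) is an immersion, and the path γ(t,θ) := t^α·c(tθ), t ∈ (0,1], has finite length: ∫₀¹ √(Σ_{i=0}^n a_i ‖∇_s^i ∂_tγ(t,·)‖²_{L²(ds)}) dt < ∞. -/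
open MeasureTheory Set Filter

noncomputable section

variable {F : Type*} [NormedAddCommGroup F] [NormedSpace ℝ F]

/-- Arc-length derivative `∇ₛ f = (∂_θ f)/|c'|` of `f` with respect to the base curve `c`. -/
def arcDeriv (c f : ℝ → F) : ℝ → F := fun θ => (‖deriv c θ‖)⁻¹ • deriv f θ

/-- Iterated arc-length derivative `∇ₛ^i f` with respect to the base curve `c`. -/
def arcIter (c : ℝ → F) : ℕ → (ℝ → F) → ℝ → F
  | 0, f => f
  | i + 1, f => arcDeriv c (arcIter c i f)

/-- A curve `c : [0,1] → F` is an immersion: it is `C¹` and `c' θ ≠ 0` for all `θ ∈ [0,1]`. -/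
def IsImmersion (c : ℝ → F) : Prop :=
  ContDiffOn ℝ 1 c (Icc (0:ℝ) 1) ∧ ∀ θ ∈ Icc (0:ℝ) 1, deriv c θ ≠ 0

/-- `f : [0,1] → F` is of class `H^m` (`m ≥ 1`): it is `C^{m-1}` and its `(m-1)`-st derivative
is the primitive of an `L²` function `g` (the weak `m`-th derivative). -/
def IsHclass (m : ℕ) (f : ℝ → F) : Prop :=
  ContDiffOn ℝ (m - 1 : ℕ) f (Icc (0:ℝ) 1) ∧
  ∃ g : ℝ → F, IntervalIntegrable g volume 0 1 ∧
    IntervalIntegrable (fun u => ‖g u‖ ^ 2) volume 0 1 ∧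
    ∀ x ∈ Icc (0:ℝ) 1,
      iteratedDeriv (m - 1) f x = iteratedDeriv (m - 1) f 0 + ∫ u in (0:ℝ)..x, g u

/-- Squared `L²(ds)` norm of `f` with respect to the base curve `c`. -/
def L2ds (c f : ℝ → F) : ℝ := ∫ θ in (0:ℝ)..1, ‖f θ‖ ^ 2 * ‖deriv c θ‖

/-- The Sobolev metric `G_c(h,h) = Σ_{i=0}^n a_i ‖∇ₛ^i h‖²_{L²(ds)}`. -/
def sobolevG (n : ℕ) (a : ℕ → ℝ) (c h : ℝ → F) : ℝ :=
  ∑ i ∈ Finset.range (n + 1), a i * L2ds c (arcIter c i h)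

/-- The velocity `∂_t γ(t,·)` of a path of curves. -/
def tderiv (γ : ℝ → ℝ → F) (t : ℝ) : ℝ → F := fun θ => deriv (fun s => γ s θ) t

/-- Riemannian length of a path of curves `γ : [0,1] → Imm([0,1],F)` for the Sobolev metric. -/
def pathLen (n : ℕ) (a : ℕ → ℝ) (γ : ℝ → ℝ → F) : ℝ :=
  ∫ t in (0:ℝ)..1, Real.sqrt (sobolevG n a (γ t) (tderiv γ t))

/-- Euclidean space `ℝ^d`. -/
abbrev Euc (d : ℕ) := EuclideanSpace ℝ (Fin d)

open Topology

abbrev II : Set ℝ := Icc (0:ℝ) 1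

lemma II_nhds {u : ℝ} (hu : u ∈ Ioo (0:ℝ) 1) : II ∈ 𝓝 u := Icc_mem_nhds hu.1 hu.2

lemma II_ud : UniqueDiffOn ℝ II := uniqueDiffOn_Icc one_pos

lemma cd_contDiff {d n : ℕ} {c : ℝ → Euc d} (hc : ContDiffOn ℝ n c II) :
    ∀ k m : ℕ, k + m = n → ContDiffOn ℝ m (iteratedDerivWithin k c II) II := by
  intro k
  induction k with
  | zero => intro m hm; rw [iteratedDerivWithin_zero]; simpa [← hm] using hc
  | succ k ih =>
    intro m hm
    have h := (ih (m+1) (by omega)).derivWithin (m := m) II_ud (by norm_cast)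
    refine h.congr fun x hx => ?_
    rw [iteratedDerivWithin_succ]

lemma hasDerivAt_within {E : Type*} [NormedAddCommGroup E] [NormedSpace ℝ E] {f : ℝ → E} {k : ℕ} (hf : ContDiffOn ℝ (k+1 : ℕ) f II)
    {u : ℝ} (hu : u ∈ Ioo (0:ℝ) 1) : HasDerivAt f (derivWithin f II u) u := by
  have h := (hf.differentiableOn (by simp)) u (Ioo_subset_Icc_self hu)
  exact h.hasDerivWithinAt.hasDerivAt (II_nhds hu)

lemma arc_struct {d n : ℕ} (hn : 2 ≤ n) (α : ℝ) {c : ℝ → Euc d} (hc : IsImmersion c)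
    (hcn : ContDiffOn ℝ n c II) : ∀ i k : ℕ, i + k = n → ∃ P : ℝ → Euc d,
      ContDiffOn ℝ k P II ∧ ∀ u ∈ Ioo (0:ℝ) 1, ∀ e,
        HasDerivAt (iteratedDerivWithin i c II) e u →
        arcIter c i (fun u => α • c u + u • deriv c u) u
          = P u + ((‖derivWithin c II u‖⁻¹) ^ i * u) • e := by
  have hdw : ∀ u ∈ II, derivWithin c II u = deriv c u := fun u hu =>
    DifferentiableAt.derivWithin (differentiableAt_of_deriv_ne_zero (hc.2 u hu)) (II_ud u hu)
  have hv : ContDiffOn ℝ (n-1 : ℕ) (fun u => ‖derivWithin c II u‖⁻¹) II := by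
    have h1 : ContDiffOn ℝ (n-1 : ℕ) (derivWithin c II) II :=
      hcn.derivWithin II_ud (by norm_cast; omega)
    refine (h1.norm ℝ fun x hx => ?_).inv fun x hx => ?_
    · rw [hdw x hx]; exact hc.2 x hx
    · rw [hdw x hx]; exact norm_ne_zero_iff.2 (hc.2 x hx)
  intro i
  induction i with
  | zero =>
    intro k hk
    refine ⟨fun u => α • c u, ?_, ?_⟩
    · obtain rfl : k = n := by omega
      exact hcn.const_smul α
    · intro u hu e he
      rw [iteratedDerivWithin_zero] at he
      simp [arcIter, he.deriv]
  | succ i ih =>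
    intro k hk
    obtain ⟨P, hP, hPe⟩ := ih (k+1) (by omega)
    have hA : ContDiffOn ℝ (k+1 : ℕ) (fun u => (‖derivWithin c II u‖⁻¹) ^ i * u) II := by
      rcases Nat.eq_zero_or_pos i with rfl | hi
      · simp only [pow_zero, one_mul]
        exact contDiffOn_id
      · exact ((hv.of_le (by norm_cast; omega)).pow i).mul contDiffOn_id
    have hcd := cd_contDiff hcn (i+1) k hk
    have hcd' := cd_contDiff hcn i (k+1) (by omega)
    have hvk : ContDiffOn ℝ k (fun u => ‖derivWithin c II u‖⁻¹) II :=
      hv.of_le (by norm_cast; omega)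
    refine ⟨fun u => ‖derivWithin c II u‖⁻¹ • (derivWithin P II u +
      (derivWithin (fun u => (‖derivWithin c II u‖⁻¹) ^ i * u) II u) •
        iteratedDerivWithin (i+1) c II u), ?_, ?_⟩
    · exact hvk.smul ((hP.derivWithin II_ud (by norm_cast)).add
        ((hA.derivWithin II_ud (by norm_cast)).smul hcd))
    · intro u hu e he
      have hloc : arcIter c i (fun u => α • c u + u • deriv c u) =ᶠ[𝓝 u]
          fun w => P w + ((‖derivWithin c II w‖⁻¹) ^ i * w) • iteratedDerivWithin (i+1) c II w := by
        filter_upwards [isOpen_Ioo.mem_nhds hu] with w hw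
        refine hPe w hw _ ?_
        rw [iteratedDerivWithin_succ]
        exact hasDerivAt_within hcd' hw
      have hd := ((hasDerivAt_within hP hu).add ((hasDerivAt_within hA hu).smul he))
      have hd' := hloc.deriv_eq.trans hd.deriv
      simp only [arcIter, arcDeriv]
      rw [hd', ← hdw u (Ioo_subset_Icc_self hu)]
      simp only [smul_add, smul_smul, pow_succ]
      module

lemma arc_bound {d n : ℕ} (hn : 2 ≤ n) (α : ℝ) {c : ℝ → Euc d} (hc : IsImmersion c)
    (hcH : IsHclass (n+1) c) : ∃ g : ℝ → Euc d, IntervalIntegrable (fun u => ‖g u‖ ^ 2) volume 0 1 ∧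
      ∀ i ≤ n, ∃ C : ℝ, 0 ≤ C ∧ ∀ᵐ u, u ∈ Ioo (0:ℝ) 1 →
        ‖arcIter c i (fun u => α • c u + u • deriv c u) u‖ ^ 2 * ‖deriv c u‖
          ≤ C * (1 + u ^ 2 * ‖g u‖ ^ 2) := by
  obtain ⟨hcn, g, hg1, hg2, hg⟩ := hcH
  simp only [Nat.add_sub_cancel] at hcn hg
  refine ⟨g, hg2, fun i hi => ?_⟩
  obtain ⟨P, hP, hPe⟩ := arc_struct hn α hc hcn i (n-i) (by omega)
  have hdw : ∀ u ∈ II, derivWithin c II u = deriv c u := fun u hu =>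
    DifferentiableAt.derivWithin (differentiableAt_of_deriv_ne_zero (hc.2 u hu)) (II_ud u hu)
  have hdc : ContinuousOn (deriv c) II :=
    (hc.1.continuousOn_derivWithin II_ud (by simp)).congr fun x hx => (hdw x hx).symm
  have hvc : ContinuousOn (fun u => (‖derivWithin c II u‖⁻¹) ^ i) II := by
    refine ContinuousOn.pow (ContinuousOn.inv₀ (hc.1.continuousOn_derivWithin II_ud (by simp)).norm ?_) i
    intro x hx
    rw [hdw x hx]; exact norm_ne_zero_iff.2 (hc.2 x hx)
  obtain ⟨M1, hM1⟩ := isCompact_Icc.exists_bound_of_continuousOn hdc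
  obtain ⟨M2, hM2⟩ := isCompact_Icc.exists_bound_of_continuousOn hvc
  obtain ⟨M3, hM3⟩ := isCompact_Icc.exists_bound_of_continuousOn hP.continuousOn
  have h0 : (0:ℝ) ∈ II := by simp
  have hM1' : 0 ≤ M1 := (norm_nonneg _).trans (hM1 0 h0)
  have hM2' : 0 ≤ M2 := (norm_nonneg _).trans (hM2 0 h0)
  have hM3' : 0 ≤ M3 := (norm_nonneg _).trans (hM3 0 h0)
  have key : ∃ K : ℝ, 0 ≤ K ∧ ∀ᵐ u, u ∈ Ioo (0:ℝ) 1 → ∃ e,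
      HasDerivAt (iteratedDerivWithin i c II) e u ∧ ‖e‖ ≤ K + ‖g u‖ := by
    rcases hi.lt_or_eq with hlt | rfl
    · obtain ⟨K, hK⟩ := isCompact_Icc.exists_bound_of_continuousOn
        (cd_contDiff hcn (i+1) (n-(i+1)) (by omega)).continuousOn
      refine ⟨K, (norm_nonneg _).trans (hK 0 h0), Eventually.of_forall fun u hu => ?_⟩
      refine ⟨_, hasDerivAt_within (cd_contDiff hcn i (n-(i+1)+1) (by omega)) hu, ?_⟩
      have := hK u (Ioo_subset_Icc_self hu)
      rw [iteratedDerivWithin_succ] at this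
      linarith [norm_nonneg (g u)]
    · refine ⟨0, le_rfl, ?_⟩
      filter_upwards [hg1.ae_hasDerivAt_integral] with u hu huI
      refine ⟨g u, ?_, by simp⟩
      have h1 := hu (by rw [uIcc_of_le zero_le_one]; exact Ioo_subset_Icc_self huI) 0 (by simp)
      refine (h1.const_add (iteratedDeriv i c 0)).congr_of_eventuallyEq ?_
      filter_upwards [isOpen_Ioo.mem_nhds huI] with w hw
      rw [← hg w (Ioo_subset_Icc_self hw)]
      exact iteratedDerivWithin_eq_iteratedDeriv II_ud (hcn.contDiffAt (II_nhds hw))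
        (Ioo_subset_Icc_self hw)
  obtain ⟨K, hK, hke⟩ := key
  refine ⟨2 * ((M3 + M2 * K) ^ 2 + M2 ^ 2) * M1, by positivity, ?_⟩
  filter_upwards [hke] with u hu huI
  obtain ⟨e, he, heb⟩ := hu huI
  have huII := Ioo_subset_Icc_self huI
  rw [hPe u huI e he]
  have hu0 := huI.1.le
  have hu1 := huI.2.le
  have hb : ‖P u + ((‖derivWithin c II u‖⁻¹) ^ i * u) • e‖ ≤ (M3 + M2 * K) + M2 * (u * ‖g u‖) := by
    calc _ ≤ ‖P u‖ + ‖(‖derivWithin c II u‖⁻¹) ^ i‖ * u * ‖e‖ := by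
          refine (norm_add_le _ _).trans ?_
          rw [norm_smul, norm_mul, Real.norm_of_nonneg hu0]
      _ ≤ M3 + M2 * u * (K + ‖g u‖) := by
          gcongr
          · exact hM3 u huII
          · exact hM2 u huII
      _ ≤ _ := by
          have : M2 * u * K ≤ M2 * K := by
            have := mul_le_mul_of_nonneg_left hu1 (mul_nonneg hM2' hK)
            nlinarith
          nlinarith
  have hd := hM1 u huII
  calc _ ≤ ((M3 + M2 * K) + M2 * (u * ‖g u‖)) ^ 2 * M1 := by gcongr
    _ ≤ (2 * ((M3 + M2 * K) ^ 2 + M2 ^ 2) * (1 + u ^ 2 * ‖g u‖ ^ 2)) * M1 := by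
        gcongr
        have := sq_nonneg ((M3 + M2 * K) - M2 * (u * ‖g u‖))
        have h3 : 0 ≤ (M3 + M2 * K) ^ 2 * (u ^ 2 * ‖g u‖ ^ 2) := by positivity
        have h4 : 0 ≤ M2 ^ 2 := by positivity
        nlinarith
    _ = _ := by ring

lemma int_bound {d n : ℕ} (hn : 2 ≤ n) (α : ℝ) {c : ℝ → Euc d} (hc : IsImmersion c)
    (hcH : IsHclass (n+1) c) : ∀ i ≤ n, ∃ C : ℝ, 0 ≤ C ∧ ∀ t ∈ Ioc (0:ℝ) 1,
      ∫ u in (0:ℝ)..t, ‖arcIter c i (fun u => α • c u + u • deriv c u) u‖ ^ 2 * ‖deriv c u‖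
        ≤ C * t := by
  obtain ⟨g, hg, hb⟩ := arc_bound hn α hc hcH
  intro i hi
  obtain ⟨C, hC, hae⟩ := hb i hi
  have hG : 0 ≤ ∫ u in (0:ℝ)..1, ‖g u‖ ^ 2 :=
    intervalIntegral.integral_nonneg zero_le_one fun u _ => by positivity
  refine ⟨C * (1 + ∫ u in (0:ℝ)..1, ‖g u‖ ^ 2), by positivity, fun t ht => ?_⟩
  have hgt : IntervalIntegrable (fun u => ‖g u‖ ^ 2) volume 0 t :=
    hg.mono_set (by rw [uIcc_of_le ht.1.le, uIcc_of_le zero_le_one]; exact Icc_subset_Icc_right ht.2)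
  have hle : ∫ u in (0:ℝ)..t, ‖g u‖ ^ 2 ≤ ∫ u in (0:ℝ)..1, ‖g u‖ ^ 2 :=
    intervalIntegral.integral_mono_interval le_rfl ht.1.le ht.2
      (Eventually.of_forall fun u => by positivity) hg
  have hint : IntervalIntegrable (fun u => C * (1 + t ^ 2 * ‖g u‖ ^ 2)) volume 0 t :=
    ((intervalIntegrable_const).add (hgt.const_mul _)).const_mul _
  have h1 : ∫ u in (0:ℝ)..t, ‖arcIter c i (fun u => α • c u + u • deriv c u) u‖ ^ 2 * ‖deriv c u‖
      ≤ ∫ u in (0:ℝ)..t, C * (1 + t ^ 2 * ‖g u‖ ^ 2) := by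
    rw [intervalIntegral.integral_of_le ht.1.le, intervalIntegral.integral_of_le ht.1.le]
    refine integral_mono_of_nonneg (Eventually.of_forall fun u => by positivity)
      ((intervalIntegrable_iff_integrableOn_Ioc_of_le ht.1.le).1 hint) ?_
    have hne : ∀ᵐ u : ℝ, u ≠ 1 := by simp [ae_iff, measure_singleton]
    rw [EventuallyLE, ae_restrict_iff' measurableSet_Ioc]
    filter_upwards [hae, hne] with u hu hu1 hut
    refine (hu ⟨hut.1, lt_of_le_of_ne (hut.2.trans ht.2) hu1⟩).trans ?_
    have := hut.1.le
    have := hut.2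
    gcongr
  refine h1.trans ?_
  rw [intervalIntegral.integral_const_mul, intervalIntegral.integral_add intervalIntegrable_const
    (hgt.const_mul _), intervalIntegral.integral_const_mul]
  simp only [intervalIntegral.integral_const, sub_zero, smul_eq_mul, mul_one]
  rw [mul_assoc]
  gcongr
  have h2 : t ^ 2 ≤ t := by nlinarith [ht.1, ht.2]
  have := mul_le_mul h2 hle (intervalIntegral.integral_nonneg ht.1.le fun u _ => by positivity) ht.1.le
  nlinarith

lemma norm_deriv_path {d : ℕ} (α : ℝ) (c : ℝ → Euc d) {t : ℝ} (ht : 0 < t) (θ : ℝ) :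
    deriv (fun θ => t ^ α • c (t * θ)) θ = (t ^ (α + 1)) • deriv c (t * θ) := by
  rw [deriv_fun_const_smul_field, deriv_comp_mul_left, smul_smul, Real.rpow_add_one ht.ne']

lemma arc_scale {d : ℕ} (α : ℝ) {c : ℝ → Euc d} (hc : IsImmersion c) {t : ℝ}
    (ht : t ∈ Ioc (0:ℝ) 1) (i : ℕ) : ∀ θ ∈ Ioo (0:ℝ) 1,
    arcIter (fun θ => t ^ α • c (t * θ)) i (tderiv (fun s θ => s ^ α • c (s * θ)) t) θ =
      (t ^ (α - 1 - i * α)) • arcIter c i (fun u => α • c u + u • deriv c u) (t * θ) := by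
  have ht0 := ht.1
  induction i with
  | zero =>
    intro θ hθ
    simp only [arcIter, tderiv]
    have hmem : t * θ ∈ II := ⟨mul_nonneg ht0.le hθ.1.le, mul_le_one₀ ht.2 hθ.1.le hθ.2.le⟩
    have hcd := (differentiableAt_of_deriv_ne_zero (hc.2 _ hmem)).hasDerivAt
    have h1 : HasDerivAt (fun s : ℝ => c (s * θ)) (θ • deriv c (t * θ)) t :=
      hcd.scomp t (by simpa using (hasDerivAt_id t).mul_const θ)
    have h2 := (Real.hasDerivAt_rpow_const (x := t) (p := α) (Or.inl ht0.ne')).smul h1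
    refine (HasDerivAt.deriv h2).trans ?_
    have h3 : t ^ α = t ^ (α - 1) * t := by
      rw [← Real.rpow_add_one ht0.ne']; simp
    rw [h3]
    simp only [Nat.cast_zero, zero_mul, sub_zero]
    module
  | succ i ih =>
    intro θ hθ
    have hloc : arcIter (fun θ => t ^ α • c (t * θ)) i (tderiv (fun s θ => s ^ α • c (s * θ)) t)
        =ᶠ[𝓝 θ] fun θ => (t ^ (α - 1 - i * α)) •
          arcIter c i (fun u => α • c u + u • deriv c u) (t * θ) := by
      filter_upwards [isOpen_Ioo.mem_nhds hθ] with w hw using ih w hw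
    simp only [arcIter, arcDeriv]
    rw [hloc.deriv_eq, norm_deriv_path α c ht0, deriv_fun_const_smul_field, deriv_comp_mul_left,
      norm_smul, Real.norm_of_nonneg (by positivity), mul_inv, smul_smul, smul_smul, smul_smul]
    congr 1
    have : t ^ (α - 1 - ((i+1 : ℕ):ℝ) * α) = (t ^ (α+1))⁻¹ * t ^ (α - 1 - i * α) * t := by
      rw [← Real.rpow_neg ht0.le, ← Real.rpow_add ht0, ← Real.rpow_add_one ht0.ne']
      congr 1; push_cast; ring
    rw [this]; ring

lemma L2_bound {d n : ℕ} (hn : 2 ≤ n) (α : ℝ) (hα0 : 0 ≤ α) {c : ℝ → Euc d} (hc : IsImmersion c)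
    (hcH : IsHclass (n+1) c) : ∀ i ≤ n, ∃ C : ℝ, 0 ≤ C ∧ ∀ t ∈ Ioc (0:ℝ) 1,
      L2ds (fun θ => t ^ α • c (t * θ)) (arcIter (fun θ => t ^ α • c (t * θ)) i
        (tderiv (fun s θ => s ^ α • c (s * θ)) t)) ≤ C * t ^ (3 * α - 1 - 2 * n * α) := by
  intro i hi
  obtain ⟨C, hC, hb⟩ := int_bound hn α hc hcH i hi
  refine ⟨C, hC, fun t ht => ?_⟩
  have ht0 := ht.1
  have hEq : L2ds (fun θ => t ^ α • c (t * θ)) (arcIter (fun θ => t ^ α • c (t * θ)) i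
        (tderiv (fun s θ => s ^ α • c (s * θ)) t)) =
      ∫ θ in (0:ℝ)..1, ((t ^ (α - 1 - i * α)) ^ 2 * t ^ (α + 1)) *
        (fun u => ‖arcIter c i (fun u => α • c u + u • deriv c u) u‖ ^ 2 * ‖deriv c u‖) (t * θ) := by
    unfold L2ds
    refine intervalIntegral.integral_congr_ae ?_
    have hne : ∀ᵐ u : ℝ, u ≠ 1 := by simp [ae_iff, measure_singleton]
    filter_upwards [hne] with θ hθ1 hθ
    rw [uIoc_of_le zero_le_one] at hθ
    have hθ' : θ ∈ Ioo (0:ℝ) 1 := ⟨hθ.1, lt_of_le_of_ne hθ.2 hθ1⟩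
    rw [arc_scale α hc ht i θ hθ', norm_deriv_path α c ht0, norm_smul, norm_smul,
      Real.norm_of_nonneg (by positivity), Real.norm_of_nonneg (by positivity)]
    ring
  rw [hEq, intervalIntegral.integral_const_mul, intervalIntegral.integral_comp_mul_left
    (fun u => ‖arcIter c i (fun u => α • c u + u • deriv c u) u‖ ^ 2 * ‖deriv c u‖) ht0.ne']
  simp only [mul_zero, mul_one, smul_eq_mul]
  have h1 := hb t ht
  calc _ ≤ ((t ^ (α - 1 - i * α)) ^ 2 * t ^ (α + 1)) * (t⁻¹ * (C * t)) := by gcongr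
    _ = C * t ^ (3 * α - 1 - 2 * i * α) := by
        have : t⁻¹ * (C * t) = C := by field_simp
        rw [this, mul_comm, ← Real.rpow_natCast, ← Real.rpow_mul ht0.le, ← Real.rpow_add ht0]
        congr 2; push_cast; ring
    _ ≤ _ := by
        refine mul_le_mul_of_nonneg_left (Real.rpow_le_rpow_of_exponent_ge ht0 ht.2 ?_) hC
        have : (i:ℝ) ≤ n := by exact_mod_cast hi
        nlinarith

/-- For `0 ≤ α < 1/(2n−3)` and an immersion `c` of class `H^{n+1}`, the
shortening–shrinking path `γ(t,θ) = t^α • c(tθ)`, `t ∈ (0,1]`, consists of immersions and has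
finite length. -/
theorem statement_12 (d n : ℕ) (hd : 1 ≤ d) (hn : 2 ≤ n) (α : ℝ)
    (hα0 : 0 ≤ α) (hα : α < 1 / (2 * (n : ℝ) - 3)) (a : ℕ → ℝ)
    (ha0 : 0 < a 0) (han : 0 < a n) (ha : ∀ i ≤ n, 0 ≤ a i)
    (c : ℝ → Euc d) (hc : IsImmersion c) (hcH : IsHclass (n + 1) c) :
    (∀ t ∈ Ioc (0:ℝ) 1, IsImmersion (fun θ => t ^ α • c (t * θ))) ∧
    (∫⁻ t in Ioc (0:ℝ) 1, ENNReal.ofReal (Real.sqrt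
        (sobolevG n a (fun θ => t ^ α • c (t * θ))
          (tderiv (fun s θ => s ^ α • c (s * θ)) t)))) < ⊤ := by
  refine ⟨fun t ht => ⟨?_, fun θ hθ => ?_⟩, ?_⟩
  · refine ContDiffOn.const_smul _ (hc.1.comp (contDiffOn_const.mul contDiffOn_id) ?_)
    intro θ hθ
    exact ⟨mul_nonneg ht.1.le hθ.1, mul_le_one₀ ht.2 hθ.1 hθ.2⟩
  · rw [norm_deriv_path α c ht.1]
    exact smul_ne_zero (Real.rpow_pos_of_pos ht.1 _).ne'
      (hc.2 _ ⟨mul_nonneg ht.1.le hθ.1, mul_le_one₀ ht.2 hθ.1 hθ.2⟩)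
  · have hL := L2_bound hn α hα0 hc hcH
    choose! C hC hb using hL
    set K := ∑ i ∈ Finset.range (n + 1), a i * C i with hK
    set β := 3 * α - 1 - 2 * n * α with hβ
    have hn' : (2:ℝ) ≤ n := by exact_mod_cast hn
    have hβ1 : -1 < β / 2 := by
      rw [lt_div_iff₀ (by linarith)] at hα
      rw [hβ]; nlinarith
    have hS : ∀ t ∈ Ioc (0:ℝ) 1, Real.sqrt (sobolevG n a (fun θ => t ^ α • c (t * θ))
          (tderiv (fun s θ => s ^ α • c (s * θ)) t)) ≤ Real.sqrt K * t ^ (β / 2) := by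
      intro t ht
      have h1 : sobolevG n a (fun θ => t ^ α • c (t * θ))
          (tderiv (fun s θ => s ^ α • c (s * θ)) t) ≤ K * t ^ β := by
        rw [hK, Finset.sum_mul]
        refine Finset.sum_le_sum fun i hi => ?_
        have hi' : i ≤ n := by simpa [Nat.lt_succ_iff] using hi
        rw [mul_assoc]
        exact mul_le_mul_of_nonneg_left (hb i hi' t ht) (ha i hi')
      have hK0 : 0 ≤ K := Finset.sum_nonneg fun i hi => by
        have hi' : i ≤ n := by simpa [Nat.lt_succ_iff] using hi
        exact mul_nonneg (ha i hi') (hC i hi')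
      refine (Real.sqrt_le_sqrt h1).trans ?_
      rw [Real.sqrt_mul hK0, Real.sqrt_eq_rpow (t ^ β), ← Real.rpow_mul ht.1.le]
      apply le_of_eq
      congr 2; ring
    have hint : IntegrableOn (fun t : ℝ => Real.sqrt K * t ^ (β / 2)) (Ioc (0:ℝ) 1) volume :=
      (intervalIntegrable_iff_integrableOn_Ioc_of_le zero_le_one).1
        ((intervalIntegral.intervalIntegrable_rpow' hβ1).const_mul _)
    refine lt_of_le_of_lt (setLIntegral_mono' measurableSet_Ioc fun t ht =>
      ENNReal.ofReal_le_ofReal (hS t ht)) ?_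
    exact hint.lintegral_lt_top
end
end

section
/- Let n ≥ 2, d ≥ 1, and let a₀, …, a_n be constants with a₀ > 0, a_n > 0, a_i ≥ 0. Let c : [0,1] → ℝ^d be a constant-speed immersion of length ℓ_c > 0 (|c'(θ)| = ℓ_c for all θ) of class H^n. Then there exists δ > 0 such that for every 0 < t < δ the linear-interpolation path γ^t(τ,θ) := τ·c(tθ) + (1−τ)·t·c'(0)·θ, τ ∈ [0,1], consists of immersions (indeed |∂_θγ^t(τ,θ)| > t·ℓ_c/2 for all τ, θ), and its length satisfies len(γ^t) → 0 as t → 0⁺. -/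
open MeasureTheory Set Filter

noncomputable section

variable {F : Type*} [NormedAddCommGroup F] [NormedSpace ℝ F]

/-- Families, indexed by `τ ∈ [0,1]`, with uniform bounds on `(0,δ)`. -/
def NiceFam {E : Type*} [NormedAddCommGroup E] [NormedSpace ℝ E] (δ : ℝ) (G : ℝ → ℝ) :
    ℕ → (ℝ → ℝ → E) → Prop
  | 0, φ => (∃ K, 0 ≤ K ∧ ∀ τ ∈ Icc (0:ℝ) 1, ∀ x ∈ Ioo 0 δ, ‖φ τ x‖ ≤ K) ∧
      ∃ K, 0 ≤ K ∧ ∀ τ ∈ Icc (0:ℝ) 1, ∀ᵐ x, x ∈ Ioo 0 δ →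
        DifferentiableAt ℝ (φ τ) x ∧ ‖deriv (φ τ) x‖ ≤ K * (1 + G x)
  | k + 1, φ => (∃ K, 0 ≤ K ∧ ∀ τ ∈ Icc (0:ℝ) 1, ∀ x ∈ Ioo 0 δ, ‖φ τ x‖ ≤ K) ∧
      (∀ τ ∈ Icc (0:ℝ) 1, ∀ x ∈ Ioo 0 δ, DifferentiableAt ℝ (φ τ) x) ∧
      NiceFam δ G k (fun τ => deriv (φ τ))

section nice
variable {E E₂ E₃ : Type*} [NormedAddCommGroup E] [NormedSpace ℝ E]
  [NormedAddCommGroup E₂] [NormedSpace ℝ E₂] [NormedAddCommGroup E₃] [NormedSpace ℝ E₃]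
  {δ : ℝ} {G : ℝ → ℝ}

theorem NiceFam.bdd {k : ℕ} {φ : ℝ → ℝ → E} (h : NiceFam δ G k φ) :
    ∃ K, 0 ≤ K ∧ ∀ τ ∈ Icc (0:ℝ) 1, ∀ x ∈ Ioo 0 δ, ‖φ τ x‖ ≤ K := by
  cases k <;> exact h.1

theorem NiceFam.ae (hG : ∀ x, 0 ≤ G x) {k : ℕ} {φ : ℝ → ℝ → E} (h : NiceFam δ G k φ) :
    ∃ K, 0 ≤ K ∧ ∀ τ ∈ Icc (0:ℝ) 1, ∀ᵐ x, x ∈ Ioo 0 δ →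
        DifferentiableAt ℝ (φ τ) x ∧ ‖deriv (φ τ) x‖ ≤ K * (1 + G x) := by
  cases k with
  | zero => exact h.2
  | succ k =>
    obtain ⟨K, hK, hb⟩ := h.2.2.bdd
    refine ⟨K, hK, fun τ hτ => Eventually.of_forall fun x hx => ⟨h.2.1 τ hτ x hx, ?_⟩⟩
    have := hb τ hτ x hx
    nlinarith [hG x]

theorem NiceFam.pred (hG : ∀ x, 0 ≤ G x) {k : ℕ} {φ : ℝ → ℝ → E} (h : NiceFam δ G (k+1) φ) :
    NiceFam δ G k φ := by
  induction k generalizing φ with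
  | zero => exact ⟨h.bdd, h.ae hG⟩
  | succ k ih => exact ⟨h.bdd, h.2.1, ih h.2.2⟩

theorem NiceFam.mono (hG : ∀ x, 0 ≤ G x) {j k : ℕ} (hjk : j ≤ k) {φ : ℝ → ℝ → E}
    (h : NiceFam δ G k φ) : NiceFam δ G j φ := by
  induction k, hjk using Nat.le_induction with
  | base => exact h
  | succ k _ ih => exact ih (h.pred hG)

theorem NiceFam.congr {k : ℕ} {φ ψ : ℝ → ℝ → E} (h : NiceFam δ G k φ)
    (he : ∀ τ ∈ Icc (0:ℝ) 1, ∀ x ∈ Ioo 0 δ, φ τ x = ψ τ x) : NiceFam δ G k ψ := by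
  have hev : ∀ τ ∈ Icc (0:ℝ) 1, ∀ x ∈ Ioo 0 δ, φ τ =ᶠ[nhds x] ψ τ := fun τ hτ x hx => by
    filter_upwards [isOpen_Ioo.mem_nhds hx] with y hy using he τ hτ y hy
  have hb : ∃ K, 0 ≤ K ∧ ∀ τ ∈ Icc (0:ℝ) 1, ∀ x ∈ Ioo 0 δ, ‖ψ τ x‖ ≤ K := by
    obtain ⟨K, hK, h⟩ := h.bdd
    exact ⟨K, hK, fun τ hτ x hx => he τ hτ x hx ▸ h τ hτ x hx⟩
  induction k generalizing φ ψ with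
  | zero =>
    refine ⟨hb, ?_⟩
    obtain ⟨K, hK, h⟩ := h.2
    refine ⟨K, hK, fun τ hτ => ?_⟩
    filter_upwards [h τ hτ] with x hx hx'
    rw [← (hev τ hτ x hx').deriv_eq]
    exact ⟨(hev τ hτ x hx').differentiableAt_iff.1 (hx hx').1, (hx hx').2⟩
  | succ k ih =>
    have hd : ∀ τ ∈ Icc (0:ℝ) 1, ∀ x ∈ Ioo 0 δ, deriv (φ τ) x = deriv (ψ τ) x :=
      fun τ hτ x hx => (hev τ hτ x hx).deriv_eq
    refine ⟨hb, fun τ hτ x hx => (hev τ hτ x hx).differentiableAt_iff.1 (h.2.1 τ hτ x hx),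
      ih h.2.2 hd ?_ ?_⟩
    · intro τ hτ x hx
      filter_upwards [isOpen_Ioo.mem_nhds hx] with y hy using hd τ hτ y hy
    · obtain ⟨K, hK, h⟩ := h.2.2.bdd
      exact ⟨K, hK, fun τ hτ x hx => hd τ hτ x hx ▸ h τ hτ x hx⟩

theorem NiceFam.add {k : ℕ} {φ ψ : ℝ → ℝ → E} (h : NiceFam δ G k φ) (h' : NiceFam δ G k ψ) :
    NiceFam δ G k (fun τ x => φ τ x + ψ τ x) := by
  have hb : ∃ K, 0 ≤ K ∧ ∀ τ ∈ Icc (0:ℝ) 1, ∀ x ∈ Ioo 0 δ, ‖φ τ x + ψ τ x‖ ≤ K := by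
    obtain ⟨K, hK, h⟩ := h.bdd
    obtain ⟨K', hK', h'⟩ := h'.bdd
    exact ⟨K + K', by positivity, fun τ hτ x hx =>
      (norm_add_le _ _).trans (add_le_add (h τ hτ x hx) (h' τ hτ x hx))⟩
  induction k generalizing φ ψ with
  | zero =>
    refine ⟨hb, ?_⟩
    obtain ⟨K, hK, h⟩ := h.2
    obtain ⟨K', hK', h'⟩ := h'.2
    refine ⟨K + K', by positivity, fun τ hτ => ?_⟩
    filter_upwards [h τ hτ, h' τ hτ] with x hx hx' hxI
    have hh := (hx hxI).1.hasDerivAt.add (hx' hxI).1.hasDerivAt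
    have e : deriv (fun y => φ τ y + ψ τ y) x = _ := hh.deriv
    refine ⟨hh.differentiableAt, ?_⟩
    rw [e, add_mul]
    exact (norm_add_le _ _).trans (add_le_add (hx hxI).2 (hx' hxI).2)
  | succ k ih =>
    refine ⟨hb, fun τ hτ x hx => (h.2.1 τ hτ x hx).add (h'.2.1 τ hτ x hx), ?_⟩
    refine (ih h.2.2 h'.2.2 ?_).congr fun τ hτ x hx => ?_
    · obtain ⟨K, hK, h⟩ := h.2.2.bdd
      obtain ⟨K', hK', h'⟩ := h'.2.2.bdd
      exact ⟨K + K', by positivity, fun τ hτ x hx =>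
        (norm_add_le _ _).trans (add_le_add (h τ hτ x hx) (h' τ hτ x hx))⟩
    · exact ((h.2.1 τ hτ x hx).hasDerivAt.add (h'.2.1 τ hτ x hx).hasDerivAt).deriv.symm

theorem NiceFam.bilin (hG : ∀ x, 0 ≤ G x) (B : E →L[ℝ] E₂ →L[ℝ] E₃) {k : ℕ}
    {φ : ℝ → ℝ → E} {ψ : ℝ → ℝ → E₂}
    (h : NiceFam δ G k φ) (h' : NiceFam δ G k ψ) :
    NiceFam δ G k (fun τ x => B (φ τ x) (ψ τ x)) := by
  have hb : ∃ K, 0 ≤ K ∧ ∀ τ ∈ Icc (0:ℝ) 1, ∀ x ∈ Ioo 0 δ, ‖B (φ τ x) (ψ τ x)‖ ≤ K := by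
    obtain ⟨K, hK, h⟩ := h.bdd
    obtain ⟨K', hK', h'⟩ := h'.bdd
    refine ⟨‖B‖ * K * K', by positivity, fun τ hτ x hx => (B.le_opNorm₂ _ _).trans ?_⟩
    have := h τ hτ x hx
    have := h' τ hτ x hx
    gcongr
  induction k generalizing φ ψ with
  | zero =>
    refine ⟨hb, ?_⟩
    obtain ⟨K₁, hK₁, h₁⟩ := h.1
    obtain ⟨K₁', hK₁', h₁'⟩ := h'.1
    obtain ⟨K, hK, h⟩ := h.2
    obtain ⟨K', hK', h'⟩ := h'.2
    refine ⟨‖B‖ * K₁ * K' + ‖B‖ * K * K₁', by positivity, fun τ hτ => ?_⟩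
    filter_upwards [h τ hτ, h' τ hτ] with x hx hx' hxI
    have hh := B.hasDerivAt_of_bilinear (fun _ => (hx hxI).1.hasDerivAt)
      (fun _ => (hx' hxI).1.hasDerivAt)
    have e : deriv (fun y => B (φ τ y) (ψ τ y)) x = _ := hh.deriv
    refine ⟨hh.differentiableAt, ?_⟩
    rw [e, add_mul]
    refine (norm_add_le _ _).trans (add_le_add ?_ ?_)
    · refine (B.le_opNorm₂ _ _).trans ?_
      rw [mul_assoc (‖B‖ * K₁)]
      have := h₁ τ hτ x hxI
      have := (hx' hxI).2
      gcongr
    · refine (B.le_opNorm₂ _ _).trans ?_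
      have e1 : ‖B‖ * K * K₁' * (1 + G x) = ‖B‖ * (K * (1 + G x)) * K₁' := by ring
      rw [e1]
      have := h₁' τ hτ x hxI
      have := (hx hxI).2
      have := hG x
      gcongr
  | succ k ih =>
    have hder : ∀ τ ∈ Icc (0:ℝ) 1, ∀ x ∈ Ioo 0 δ, HasDerivAt (fun y => B (φ τ y) (ψ τ y))
        (B (φ τ x) (deriv (ψ τ) x) + B (deriv (φ τ) x) (ψ τ x)) x := fun τ hτ x hx =>
      B.hasDerivAt_of_bilinear (fun _ => (h.2.1 τ hτ x hx).hasDerivAt)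
        (fun _ => (h'.2.1 τ hτ x hx).hasDerivAt)
    have key : ∀ {φ : ℝ → ℝ → E} {ψ : ℝ → ℝ → E₂}, NiceFam δ G k φ → NiceFam δ G k ψ →
        ∃ K, 0 ≤ K ∧ ∀ τ ∈ Icc (0:ℝ) 1, ∀ x ∈ Ioo 0 δ, ‖B (φ τ x) (ψ τ x)‖ ≤ K := by
      intro φ ψ h h'
      obtain ⟨K, hK, h⟩ := h.bdd
      obtain ⟨K', hK', h'⟩ := h'.bdd
      refine ⟨‖B‖ * K * K', by positivity, fun τ hτ x hx => (B.le_opNorm₂ _ _).trans ?_⟩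
      have := h τ hτ x hx
      have := h' τ hτ x hx
      gcongr
    refine ⟨hb, fun τ hτ x hx => (hder τ hτ x hx).differentiableAt, ?_⟩
    refine NiceFam.congr ((ih (h.pred hG) h'.2.2 (key (h.pred hG) h'.2.2)).add
      (ih h.2.2 (h'.pred hG) (key h.2.2 (h'.pred hG)))) fun τ hτ x hx => ?_
    exact (hder τ hτ x hx).deriv.symm

theorem niceFam_zero (hG : ∀ x, 0 ≤ G x) (k : ℕ) :
    NiceFam δ G k (fun _ _ => (0 : E)) := by
  induction k with
  | zero =>
    refine ⟨⟨0, le_rfl, by simp⟩, 0, le_rfl, fun τ _ => Eventually.of_forall fun x _ => by simp⟩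
  | succ k ih =>
    refine ⟨⟨0, le_rfl, by simp⟩, fun τ _ x _ => by simp, ?_⟩
    simpa using ih

theorem niceFam_param (hG : ∀ x, 0 ≤ G x) (k : ℕ) (f : ℝ → E) (K : ℝ)
    (hf : ∀ τ ∈ Icc (0:ℝ) 1, ‖f τ‖ ≤ K) :
    NiceFam δ G k (fun τ _ => f τ) := by
  refine NiceFam.pred hG ⟨⟨max K 0, le_max_right _ _, fun τ hτ x _ =>
    (hf τ hτ).trans (le_max_left _ _)⟩, fun τ _ x _ => by simp, ?_⟩
  simpa using niceFam_zero hG k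

theorem niceFam_id (hG : ∀ x, 0 ≤ G x) (k : ℕ) :
    NiceFam δ G k (fun _ x => x) := by
  refine NiceFam.pred hG ⟨⟨max δ 0, le_max_right _ _, fun τ hτ x hx => ?_⟩,
    fun τ _ x _ => by simp, ?_⟩
  · rw [Real.norm_of_nonneg hx.1.le]
    exact hx.2.le.trans (le_max_left _ _)
  · simpa using niceFam_param hG k (fun _ => (1:ℝ)) 1 (by simp)

theorem niceFam_smul (hG : ∀ x, 0 ≤ G x) {k : ℕ}
    {φ : ℝ → ℝ → ℝ} {ψ : ℝ → ℝ → E}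
    (h : NiceFam δ G k φ) (h' : NiceFam δ G k ψ) :
    NiceFam δ G k (fun τ x => φ τ x • ψ τ x) :=
  NiceFam.bilin hG (ContinuousLinearMap.lsmul ℝ ℝ) h h'

end nice

section inv
variable {E : Type*} [NormedAddCommGroup E] [InnerProductSpace ℝ E] {δ : ℝ} {G : ℝ → ℝ}

theorem hasDerivAt_inv_norm {f : ℝ → E} {f' : E} {x : ℝ} (h : HasDerivAt f f' x) (h0 : f x ≠ 0) :
    HasDerivAt (fun y => ‖f y‖⁻¹) ((-(‖f x‖⁻¹ * (‖f x‖⁻¹ * ‖f x‖⁻¹))) * inner ℝ (f x) f') x := by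
  have hn : ‖f x‖ ≠ 0 := norm_ne_zero_iff.2 h0
  have h1 := (h.norm_sq.sqrt (pow_ne_zero 2 hn)).inv (by simpa using hn)
  simp only [Real.sqrt_sq (norm_nonneg _)] at h1
  refine (h1.congr_of_eventuallyEq ?_).congr_deriv ?_
  · exact Eventually.of_forall fun y => by simp
  · field_simp

theorem niceFam_inv_norm (hG : ∀ x, 0 ≤ G x) {m : ℝ} (hm : 0 < m) {k : ℕ} {φ : ℝ → ℝ → E}
    (h : NiceFam δ G k φ) (hφ : ∀ τ ∈ Icc (0:ℝ) 1, ∀ x ∈ Ioo 0 δ, m ≤ ‖φ τ x‖) :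
    NiceFam δ G k (fun τ x => ‖φ τ x‖⁻¹) := by
  have h0 : ∀ τ ∈ Icc (0:ℝ) 1, ∀ x ∈ Ioo 0 δ, φ τ x ≠ 0 := fun τ hτ x hx =>
    norm_pos_iff.1 (hm.trans_le (hφ τ hτ x hx))
  have hi : ∀ τ ∈ Icc (0:ℝ) 1, ∀ x ∈ Ioo 0 δ, ‖φ τ x‖⁻¹ ≤ m⁻¹ := fun τ hτ x hx =>
    inv_anti₀ hm (hφ τ hτ x hx)
  have hb : ∃ K, 0 ≤ K ∧ ∀ τ ∈ Icc (0:ℝ) 1, ∀ x ∈ Ioo 0 δ, ‖‖φ τ x‖⁻¹‖ ≤ K :=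
    ⟨m⁻¹, by positivity, fun τ hτ x hx => by simpa using hi τ hτ x hx⟩
  induction k with
  | zero =>
    refine ⟨hb, ?_⟩
    obtain ⟨K₁, hK₁, h₁⟩ := h.1
    obtain ⟨K, hK, h⟩ := h.2
    refine ⟨(m⁻¹ * (m⁻¹ * m⁻¹)) * (K₁ * K), by positivity, fun τ hτ => ?_⟩
    filter_upwards [h τ hτ] with x hx hxI
    have hh := hasDerivAt_inv_norm (hx hxI).1.hasDerivAt (h0 τ hτ x hxI)
    refine ⟨hh.differentiableAt, ?_⟩
    rw [hh.deriv, norm_mul, norm_neg, norm_mul, norm_mul, norm_inv, norm_norm, mul_assoc _ (K₁ * K),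
      mul_assoc K₁]
    have := hi τ hτ x hxI
    have h2 : ‖inner ℝ (φ τ x) (deriv (φ τ) x)‖ ≤ K₁ * (K * (1 + G x)) := by
      refine (norm_inner_le_norm _ _).trans ?_
      have := h₁ τ hτ x hxI
      have := (hx hxI).2
      gcongr
    gcongr
  | succ k ih =>
    have hder := fun τ hτ x hx => hasDerivAt_inv_norm (h.2.1 τ hτ x hx).hasDerivAt (h0 τ hτ x hx)
    refine ⟨hb, fun τ hτ x hx => (hder τ hτ x hx).differentiableAt, ?_⟩
    have hv := ih (h.pred hG)
    have h3 := niceFam_smul hG (niceFam_param hG k (fun _ => (-1:ℝ)) 1 (by simp))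
      (niceFam_smul hG hv (niceFam_smul hG hv hv))
    have h4 := NiceFam.bilin hG (innerSL ℝ) (h.pred hG) h.2.2
    refine (niceFam_smul hG h3 h4).congr fun τ hτ x hx => ?_
    rw [(hder τ hτ x hx).deriv]
    simp only [smul_eq_mul, neg_mul, one_mul]
    rfl

end inv

theorem niceFam_curve {E : Type*} [NormedAddCommGroup E] [NormedSpace ℝ E] [CompleteSpace E]
    {δ : ℝ} (hδ : δ ≤ 1) (c g : ℝ → E) (m : ℕ) (hC : ContDiffOn ℝ m c (Icc (0:ℝ) 1))
    (hg : IntervalIntegrable g volume 0 1)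
    (he : ∀ x ∈ Icc (0:ℝ) 1, iteratedDeriv m c x = iteratedDeriv m c 0 + ∫ u in (0:ℝ)..x, g u) :
    ∀ k j : ℕ, k + j = m → NiceFam δ (fun x => ‖g x‖) k (fun _ => iteratedDeriv j c) := by
  have hsub : ∀ x ∈ Ioo 0 δ, x ∈ Ioo (0:ℝ) 1 := fun x hx => ⟨hx.1, hx.2.trans_le hδ⟩
  have hU : UniqueDiffOn ℝ (Icc (0:ℝ) 1) := uniqueDiffOn_Icc zero_lt_one
  have hat : ∀ x ∈ Ioo (0:ℝ) 1, ContDiffAt ℝ m c x := fun x hx =>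
    hC.contDiffAt (Icc_mem_nhds hx.1 hx.2)
  have heq : ∀ j ≤ m, ∀ x ∈ Ioo (0:ℝ) 1,
      iteratedDerivWithin j c (Icc 0 1) x = iteratedDeriv j c x := fun j hj x hx =>
    iteratedDerivWithin_eq_iteratedDeriv hU ((hat x hx).of_le (by exact_mod_cast hj))
      (Ioo_subset_Icc_self hx)
  have hb : ∀ j ≤ m, ∃ K, 0 ≤ K ∧ ∀ τ ∈ Icc (0:ℝ) 1, ∀ x ∈ Ioo 0 δ,
      ‖iteratedDeriv j c x‖ ≤ K := by
    intro j hj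
    obtain ⟨K, hK⟩ := isCompact_Icc.exists_bound_of_continuousOn
      (hC.continuousOn_iteratedDerivWithin (m := j) (by exact_mod_cast hj) hU)
    refine ⟨K, (norm_nonneg _).trans (hK 0 (by simp)), fun τ _ x hx => ?_⟩
    rw [← heq j hj x (hsub x hx)]
    exact hK x (Ioo_subset_Icc_self (hsub x hx))
  intro k
  induction k with
  | zero =>
    intro j hj
    obtain rfl : j = m := by omega
    refine ⟨hb j le_rfl, 1, zero_le_one, fun τ _ => ?_⟩
    filter_upwards [hg.ae_hasDerivAt_integral] with x hx hxI
    have h1 := (hx (by simpa using Ioo_subset_Icc_self (hsub x hxI)) 0 (by simp)).const_add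
      (iteratedDeriv j c 0)
    have h2 : HasDerivAt (iteratedDeriv j c) (g x) x := by
      refine h1.congr_of_eventuallyEq ?_
      filter_upwards [isOpen_Ioo.mem_nhds (hsub x hxI)] with y hy
      exact he y (Ioo_subset_Icc_self hy)
    refine ⟨h2.differentiableAt, ?_⟩
    rw [h2.deriv]
    linarith
  | succ k ih =>
    intro j hj
    refine ⟨hb j (by omega), fun τ _ x hx => ?_, ?_⟩
    · have h1 := hC.differentiableOn_iteratedDerivWithin (m := j)
        (by exact_mod_cast (by omega : j < m)) hU
      have h2 := (h1 x (Ioo_subset_Icc_self (hsub x hx))).differentiableAt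
        (Icc_mem_nhds (hsub x hx).1 (hsub x hx).2)
      refine h2.congr_of_eventuallyEq ?_
      filter_upwards [isOpen_Ioo.mem_nhds (hsub x hx)] with y hy
      exact (heq j (by omega) y hy).symm
    · simpa only [iteratedDeriv_succ] using ih (j + 1) (by omega)

theorem niceFam_arcIter {E : Type*} [NormedAddCommGroup E] [NormedSpace ℝ E]
    {δ : ℝ} {G : ℝ → ℝ} (hG : ∀ x, 0 ≤ G x) {k : ℕ} (γ : ℝ → ℝ → E) (h : ℝ → E)
    (hv : NiceFam δ G k (fun τ x => ‖deriv (γ τ) x‖⁻¹))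
    (hh : NiceFam δ G (k + 1) (fun _ => h)) :
    ∀ i j : ℕ, i + j = k + 1 → NiceFam δ G j (fun τ => arcIter (γ τ) i h) := by
  intro i
  induction i with
  | zero =>
    intro j hj
    obtain rfl : j = k + 1 := by omega
    exact hh
  | succ i ih =>
    intro j hj
    have h1 := ih (j + 1) (by omega)
    exact niceFam_smul hG (hv.mono hG (by omega)) h1.2.2

theorem arcIter_bound {E : Type*} [NormedAddCommGroup E] [NormedSpace ℝ E]
    {δ : ℝ} {G : ℝ → ℝ} (hG : ∀ x, 0 ≤ G x) {k : ℕ} (γ : ℝ → ℝ → E) (h : ℝ → E)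
    (hv : NiceFam δ G k (fun τ x => ‖deriv (γ τ) x‖⁻¹))
    (hh : NiceFam δ G (k + 1) (fun _ => h)) :
    ∃ K, 0 ≤ K ∧ ∀ i ≤ k + 2, ∀ τ ∈ Icc (0:ℝ) 1, ∀ᵐ x, x ∈ Ioo 0 δ →
      ‖arcIter (γ τ) i h x‖ ≤ K * (1 + G x) := by
  have h1 : ∀ i, ∃ K, 0 ≤ K ∧ (i ≤ k + 2 → ∀ τ ∈ Icc (0:ℝ) 1, ∀ᵐ x, x ∈ Ioo 0 δ →
      ‖arcIter (γ τ) i h x‖ ≤ K * (1 + G x)) := by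
    intro i
    rcases Nat.lt_or_ge i (k + 2) with hi | hi
    · obtain ⟨K, hK, hb⟩ := (niceFam_arcIter hG γ h hv hh i (k + 1 - i) (by omega)).bdd
      refine ⟨K, hK, fun _ τ hτ => Eventually.of_forall fun x hx => ?_⟩
      have := hb τ hτ x hx
      nlinarith [hG x]
    · rcases hi.eq_or_lt with rfl | hi
      · obtain ⟨K, hK, hb⟩ := (niceFam_arcIter hG γ h hv hh (k + 1) 0 (by omega)).ae hG
        obtain ⟨K', hK', hb'⟩ := hv.bdd
        refine ⟨K' * K, by positivity, fun _ τ hτ => ?_⟩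
        filter_upwards [hb τ hτ] with x hx hxI
        have e : arcIter (γ τ) (k + 2) h x =
          ‖deriv (γ τ) x‖⁻¹ • deriv (arcIter (γ τ) (k + 1) h) x := rfl
        rw [e, norm_smul, mul_assoc]
        have := hb' τ hτ x hxI
        have := (hx hxI).2
        gcongr
      · exact ⟨0, le_rfl, fun h => by omega⟩
  choose K hK hb using h1
  refine ⟨∑ i ∈ Finset.range (k + 3), K i, Finset.sum_nonneg fun i _ => hK i,
    fun i hi τ hτ => ?_⟩
  filter_upwards [hb i hi τ hτ] with x hx hxI
  refine (hx hxI).trans ?_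
  have h2 : K i ≤ ∑ i ∈ Finset.range (k + 3), K i :=
    Finset.single_le_sum (f := K) (fun i _ => hK i) (Finset.mem_range.2 (by omega))
  have := hG x
  gcongr

theorem arcIter_scale {E : Type*} [NormedAddCommGroup E] [NormedSpace ℝ E] {t : ℝ} (ht : 0 < t)
    (γ h : ℝ → E) (i : ℕ) :
    arcIter (fun θ => γ (t * θ)) i (fun θ => h (t * θ)) = fun θ => arcIter γ i h (t * θ) := by
  induction i with
  | zero => rfl
  | succ i ih =>
    funext θ
    change ‖deriv (fun θ => γ (t * θ)) θ‖⁻¹ • deriv (arcIter (fun θ => γ (t * θ)) i _) θ =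
      ‖deriv γ (t * θ)‖⁻¹ • deriv (arcIter γ i h) (t * θ)
    rw [ih, deriv_comp_mul_left t γ, deriv_comp_mul_left t (arcIter γ i h), norm_smul,
      Real.norm_of_nonneg ht.le, mul_inv, smul_smul]
    congr 1
    field_simp

theorem ae_scale {t : ℝ} (ht : 0 < t) {P : ℝ → Prop} (h : ∀ᵐ x : ℝ, P x) :
    ∀ᵐ x : ℝ, P (t * x) := by
  rw [ae_iff] at h ⊢
  have := Real.volume_preimage_mul_left ht.ne' {x | ¬ P x}
  rw [h, mul_zero] at this
  exact this

theorem L2ds_scale_le {E : Type*} [NormedAddCommGroup E] [NormedSpace ℝ E] {t δ K ℓ : ℝ}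
    (ht : 0 < t) (htδ : t < δ) (hδ : δ ≤ 1) (hK : 0 ≤ K) {G : ℝ → ℝ} (hG : ∀ x, 0 ≤ G x)
    (hint : IntervalIntegrable (fun x => (1 + G x) ^ 2) volume 0 1)
    (γ f : ℝ → E) (hγ : ∀ x ∈ Ioo 0 δ, ‖deriv γ x‖ ≤ ℓ)
    (hf : ∀ᵐ x, x ∈ Ioo 0 δ → ‖f x‖ ≤ K * (1 + G x)) :
    L2ds (fun θ => γ (t * θ)) (fun θ => f (t * θ)) ≤
      K ^ 2 * ℓ * ∫ x in (0:ℝ)..t, (1 + G x) ^ 2 := by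
  have ht1 : t ≤ 1 := (htδ.le.trans hδ)
  have hint' : IntervalIntegrable (fun x => (1 + G x) ^ 2) volume 0 t :=
    hint.mono_set (by rw [uIcc_of_le ht.le, uIcc_of_le zero_le_one]; exact Icc_subset_Icc_right ht1)
  have hint'' : IntervalIntegrable (fun x => (1 + G (t * x)) ^ 2) volume 0 1 := by
    have := hint'.comp_mul_left (c := t)
    simpa [ht.ne'] using this
  have e : ∫ x in (0:ℝ)..t, (1 + G x) ^ 2 = t * ∫ x in (0:ℝ)..1, (1 + G (t * x)) ^ 2 := by
    have := intervalIntegral.mul_integral_comp_mul_left (a := 0) (b := 1)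
      (f := fun x => (1 + G x) ^ 2) t
    simpa using this.symm
  rw [e, ← mul_assoc, ← intervalIntegral.integral_const_mul]
  unfold L2ds
  rw [intervalIntegral.integral_of_le zero_le_one, intervalIntegral.integral_of_le zero_le_one]
  refine integral_mono_of_nonneg (Eventually.of_forall fun x => by positivity)
    (hint''.const_mul _).1 ?_
  rw [EventuallyLE, ae_restrict_iff' measurableSet_Ioc]
  filter_upwards [ae_scale ht hf] with x hx hxI
  have hx' : t * x ∈ Ioo 0 δ := ⟨mul_pos ht hxI.1, by nlinarith [hxI.2]⟩
  have h1 := hx hx'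
  have h2 := hγ _ hx'
  have h3 := hG (t * x)
  rw [deriv_comp_mul_left t γ, norm_smul, Real.norm_of_nonneg ht.le]
  calc ‖f (t * x)‖ ^ 2 * (t * ‖deriv γ (t * x)‖)
      ≤ (K * (1 + G (t * x))) ^ 2 * (t * ℓ) := by gcongr
    _ = K ^ 2 * ℓ * t * (1 + G (t * x)) ^ 2 := by ring

/-- For a constant-speed immersion `c` of length `ℓ > 0` of class `H^n`,
there is `δ > 0` such that for `0 < t < δ` the linear interpolation path
`γ^t(τ,θ) = τ • c(tθ) + (1−τ)·t·θ • c'(0)` consists of immersions (with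
`|∂_θγ^t(τ,θ)| > t·ℓ/2`), and `len(γ^t) → 0` as `t → 0⁺`. -/
theorem statement_14 (d n : ℕ) (hd : 1 ≤ d) (hn : 2 ≤ n) (a : ℕ → ℝ)
    (ha0 : 0 < a 0) (han : 0 < a n) (ha : ∀ i ≤ n, 0 ≤ a i)
    (c : ℝ → Euc d) (ℓ : ℝ) (hℓ : 0 < ℓ)
    (hc : IsImmersion c) (hcH : IsHclass n c)
    (hspeed : ∀ θ ∈ Icc (0:ℝ) 1, ‖deriv c θ‖ = ℓ) :
    (∃ δ > (0:ℝ), ∀ t : ℝ, 0 < t → t < δ →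
      (∀ τ ∈ Icc (0:ℝ) 1, ∀ θ ∈ Icc (0:ℝ) 1,
        t * ℓ / 2 < ‖deriv (fun θ' => τ • c (t * θ') + ((1 - τ) * t * θ') • deriv c 0) θ‖) ∧
      (∀ τ ∈ Icc (0:ℝ) 1,
        IsImmersion (fun θ' => τ • c (t * θ') + ((1 - τ) * t * θ') • deriv c 0))) ∧
    Tendsto (fun t : ℝ =>
        pathLen n a (fun τ θ' => τ • c (t * θ') + ((1 - τ) * t * θ') • deriv c 0))
      (nhdsWithin 0 (Ioi 0)) (nhds 0) := by
  obtain ⟨k, rfl⟩ : ∃ k, n = k + 2 := ⟨n - 2, by omega⟩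
  obtain ⟨hC, g, hgI, hg2, hge⟩ := hcH
  have ek : k + 2 - 1 = k + 1 := by omega
  rw [ek] at hC hge
  -- `c` is differentiable at each point of `[0,1]`, with continuous derivative
  have hdiff : ∀ x ∈ Icc (0:ℝ) 1, DifferentiableAt ℝ c x := fun x hx =>
    differentiableAt_of_deriv_ne_zero (hc.2 x hx)
  have hU : UniqueDiffOn ℝ (Icc (0:ℝ) 1) := uniqueDiffOn_Icc zero_lt_one
  have hcont : ContinuousOn (deriv c) (Icc (0:ℝ) 1) :=
    (hc.1.continuousOn_derivWithin hU le_rfl).congr fun x hx =>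
      ((hdiff x hx).derivWithin (hU x hx)).symm
  set v := deriv c 0 with hv
  obtain ⟨δ₀, hδ₀, hclose⟩ := Metric.continuousWithinAt_iff.1 (hcont 0 (by simp)) (ℓ / 2) (by positivity)
  obtain ⟨δ, hδ, hδ1, hδδ⟩ : ∃ δ : ℝ, 0 < δ ∧ δ ≤ 1 ∧ δ ≤ δ₀ :=
    ⟨min 1 δ₀, by positivity, min_le_left _ _, min_le_right _ _⟩
  have hv0 : ‖v‖ = ℓ := hspeed 0 (by simp)
  let γ : ℝ → ℝ → Euc d := fun τ x => τ • c x + ((1 - τ) * x) • v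
  have hγd : ∀ τ, ∀ x ∈ Icc (0:ℝ) 1, HasDerivAt (γ τ) (τ • deriv c x + (1 - τ) • v) x := by
    intro τ x hx
    have h1 := (hdiff x hx).hasDerivAt.const_smul τ
    have h2 := ((hasDerivAt_id x).const_mul (1 - τ)).smul_const v
    simpa [γ] using! h1.add h2
  have hlow : ∀ τ ∈ Icc (0:ℝ) 1, ∀ x ∈ Ico 0 δ, ℓ / 2 < ‖deriv (γ τ) x‖ := by
    intro τ hτ x hx
    have hx1 : x ∈ Icc (0:ℝ) 1 := ⟨hx.1, hx.2.le.trans hδ1⟩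
    rw [(hγd τ x hx1).deriv]
    have h1 : ‖deriv c x - v‖ < ℓ / 2 := by
      rw [← dist_eq_norm]
      refine hclose hx1 ?_
      rw [Real.dist_eq, sub_zero, abs_of_nonneg hx.1]
      exact hx.2.trans_le hδδ
    have h2 : v = (τ • deriv c x + (1 - τ) • v) - τ • (deriv c x - v) := by module
    have h3 : ‖v‖ ≤ ‖τ • deriv c x + (1 - τ) • v‖ + ‖τ • (deriv c x - v)‖ := by
      conv_lhs => rw [h2]
      exact norm_sub_le _ _
    rw [norm_smul, Real.norm_of_nonneg hτ.1, hv0] at h3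
    nlinarith [hτ.1, hτ.2, norm_nonneg (deriv c x - v)]
  have hup : ∀ τ ∈ Icc (0:ℝ) 1, ∀ x ∈ Ioo 0 δ, ‖deriv (γ τ) x‖ ≤ ℓ := by
    intro τ hτ x hx
    have hx1 : x ∈ Icc (0:ℝ) 1 := ⟨hx.1.le, hx.2.le.trans hδ1⟩
    rw [(hγd τ x hx1).deriv]
    refine (norm_add_le _ _).trans ?_
    rw [norm_smul, norm_smul, hspeed x hx1, hv0, Real.norm_of_nonneg hτ.1,
      Real.norm_of_nonneg (sub_nonneg.2 hτ.2)]
    linarith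
  have hscale : ∀ t τ : ℝ, (fun θ' => τ • c (t * θ') + ((1 - τ) * t * θ') • v) =
      fun θ => γ τ (t * θ) := by
    intro t τ
    funext θ
    simp only [γ, mul_assoc]
  have hmem : ∀ t, 0 < t → t < δ → ∀ θ ∈ Icc (0:ℝ) 1, t * θ ∈ Ico 0 δ := fun t ht htδ θ hθ =>
    ⟨mul_nonneg ht.le hθ.1, by nlinarith [hθ.2]⟩
  have hlow' : ∀ t, 0 < t → t < δ → ∀ τ ∈ Icc (0:ℝ) 1, ∀ θ ∈ Icc (0:ℝ) 1,
      t * ℓ / 2 < ‖deriv (fun θ => γ τ (t * θ)) θ‖ := by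
    intro t ht htδ τ hτ θ hθ
    rw [deriv_comp_mul_left t (γ τ), norm_smul, Real.norm_of_nonneg ht.le, mul_div_assoc]
    exact mul_lt_mul_of_pos_left (hlow τ hτ _ (hmem t ht htδ θ hθ)) ht
  refine ⟨⟨δ, hδ, fun t ht htδ => ⟨fun τ hτ θ hθ => ?_, fun τ hτ => ⟨?_, fun θ hθ => ?_⟩⟩⟩, ?_⟩
  · rw [hscale]
    exact hlow' t ht htδ τ hτ θ hθ
  · have h1 : ContDiffOn ℝ 1 (fun θ : ℝ => c (t * θ)) (Icc 0 1) :=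
      hc.1.comp (by fun_prop) fun θ hθ =>
        Ico_subset_Icc_self (Ico_subset_Ico_right hδ1 (hmem t ht htδ θ hθ))
    exact (h1.const_smul τ).add (by fun_prop)
  · rw [hscale]
    exact norm_pos_iff.1 (lt_trans (by positivity) (hlow' t ht htδ τ hτ θ hθ))
  -- the length
  let G : ℝ → ℝ := fun x => ‖g x‖
  have hG : ∀ x, 0 ≤ G x := fun x => norm_nonneg _
  let h : ℝ → Euc d := fun x => c x + (-x) • v
  have hcN : NiceFam δ G (k + 1) (fun _ => c) := by
    simpa using niceFam_curve hδ1 c g (k + 1) (by exact_mod_cast hC) hgI hge (k + 1) 0 rfl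
  have hvN : ∀ j, NiceFam δ G j (fun _ _ => v) := fun j =>
    niceFam_param hG j (fun _ => v) ‖v‖ (by simp)
  have hhN : NiceFam δ G (k + 1) (fun _ => h) := by
    have h1 := niceFam_smul hG (niceFam_smul hG (niceFam_param hG (k + 1) (fun _ => (-1:ℝ)) 1
      (by simp)) (niceFam_id hG (k + 1))) (hvN (k + 1))
    refine (hcN.add h1).congr fun τ _ x _ => ?_
    simp [h]
  have hγN : NiceFam δ G (k + 1) γ := by
    have h1 := niceFam_smul hG (niceFam_smul hG (niceFam_param (δ := δ) hG (k + 1)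
      (fun τ => (1 - τ:ℝ)) 1
      (fun τ hτ => by rw [Real.norm_of_nonneg (sub_nonneg.2 hτ.2)]; linarith [hτ.1]))
      (niceFam_id hG (k + 1))) (hvN (k + 1))
    have h2 := niceFam_smul hG (niceFam_param (δ := δ) hG (k + 1) (fun τ => (τ:ℝ)) 1
      (fun τ hτ => by rw [Real.norm_of_nonneg hτ.1]; exact hτ.2)) hcN
    refine (h2.add h1).congr fun τ _ x _ => ?_
    simp [γ]
  have hinv := niceFam_inv_norm hG (half_pos hℓ) hγN.2.2
    fun τ hτ x hx => (hlow τ hτ x (Ioo_subset_Ico_self hx)).le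
  obtain ⟨K, hK, hbound⟩ := arcIter_bound hG γ h hinv hhN
  have hint : IntervalIntegrable (fun x => (1 + G x) ^ 2) volume 0 1 := by
    have h1 := ((intervalIntegrable_const (c := (1:ℝ)) (μ := volume) (a := 0) (b := 1)).add
      (hgI.norm.const_mul 2)).add hg2
    refine h1.congr ?_
    intro x _
    simp only [G]
    ring
  let I : ℝ → ℝ := fun t => ∫ x in (0:ℝ)..t, (1 + G x) ^ 2
  let A : ℝ := ∑ i ∈ Finset.range (k + 2 + 1), a i
  have hlen : ∀ t, 0 < t → t < δ →
      ‖pathLen (k + 2) a (fun τ θ' => τ • c (t * θ') + ((1 - τ) * t * θ') • v)‖ ≤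
        Real.sqrt (A * (K ^ 2 * ℓ * I t)) := by
    intro t ht htδ
    unfold pathLen
    refine (intervalIntegral.norm_integral_le_of_norm_le_const
      (C := Real.sqrt (A * (K ^ 2 * ℓ * I t))) fun τ hτ => ?_).trans (by simp)
    rw [uIoc_of_le zero_le_one] at hτ
    have hτ' : τ ∈ Icc (0:ℝ) 1 := Ioc_subset_Icc_self hτ
    rw [Real.norm_of_nonneg (Real.sqrt_nonneg _)]
    refine Real.sqrt_le_sqrt ?_
    have e1 : tderiv (fun τ θ' => τ • c (t * θ') + ((1 - τ) * t * θ') • v) τ =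
        fun θ => h (t * θ) := by
      funext θ
      have h1 := (hasDerivAt_id τ).smul_const (c (t * θ))
      have h2 := (((hasDerivAt_id τ).const_sub 1).mul_const (t * θ)).smul_const v
      have h3 : HasDerivAt (fun s : ℝ => s • c (t * θ) + ((1 - s) * t * θ) • v) (h (t * θ)) τ := by
        simpa [h, mul_assoc] using! h1.add h2
      exact h3.deriv
    rw [e1]
    simp only [hscale]
    unfold sobolevG
    simp only [A, Finset.sum_mul]
    refine Finset.sum_le_sum fun i hi => ?_
    have hi' : i ≤ k + 2 := Nat.lt_succ_iff.1 (Finset.mem_range.1 hi)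
    refine mul_le_mul_of_nonneg_left ?_ (ha i hi')
    rw [arcIter_scale ht]
    exact L2ds_scale_le ht htδ hδ1 hK hG hint (γ τ) _ (hup τ hτ') (hbound i hi' τ hτ')
  have hI : Tendsto I (nhdsWithin 0 (Ioi 0)) (nhds 0) := by
    have h1 := intervalIntegral.continuousOn_primitive_interval' hint (by simp : (0:ℝ) ∈ uIcc 0 1)
    have h2 := h1 0 (by simp)
    rw [uIcc_of_le zero_le_one] at h2
    have h3 : Tendsto I (nhdsWithin 0 (Icc 0 1)) (nhds (I 0)) := h2
    have h4 : I 0 = 0 := by simp [I]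
    rw [h4] at h3
    refine h3.mono_left (nhdsWithin_le_of_mem ?_)
    exact mem_of_superset (Ioo_mem_nhdsGT zero_lt_one) Ioo_subset_Icc_self
  have hS : Tendsto (fun t => Real.sqrt (A * (K ^ 2 * ℓ * I t))) (nhdsWithin 0 (Ioi 0)) (nhds 0) := by
    have := ((hI.const_mul (K ^ 2 * ℓ)).const_mul A).sqrt
    simpa using this
  refine squeeze_zero_norm' ?_ hS
  filter_upwards [Ioo_mem_nhdsGT hδ] with t ht
  exact hlen t ht.1 ht.2
end
end
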